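/- Suppose for each i ∈ {1,…,N} there is a twice continuously differentiable curve w_i : [0,1] → ℝ^d with ∇F_{S,t,i}(w_i(t)) = 0 for every t ∈ [0,1], with w_i(0) = ŵ the global minimizer of F_S and w_i(1) = ŵ_{-i} the global minimizer of F_{S,1,i} = F_{S,-i}. Then the average change in test loss after deleting a uniformly random training point satisfies (1/N)·Σ_{i=1}^N [L(ŵ_{-i}) − L(ŵ)] ≤ −λD/N + C/2, where H₀ := ∇²F_S(ŵ), D := ⟨∇L(ŵ), H₀⁻¹( −(1/λ)·Σ_{i=1}^N ∇ℓ_i(ŵ) )⟩, C := 3HG²/α² + β̄G³/α³, and β̄ := N·β + λ·β_R. -/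

import Mathlib

open scoped RealInnerProductSpace BigOperators

/-- The Hessian of `f : ℝ^d → ℝ` at `w`, viewed as a continuous linear map on `ℝ^d`,
obtained as the Fréchet derivative of the gradient map. -/
noncomputable def hessian {d : ℕ} (f : EuclideanSpace ℝ (Fin d) → ℝ)
    (w : EuclideanSpace ℝ (Fin d)) :
    EuclideanSpace ℝ (Fin d) →L[ℝ] EuclideanSpace ℝ (Fin d) :=
  fderiv ℝ (gradient f) w

/-- The regularized empirical risk `F_S(w) = ∑ i, ℓ_i(w) + λ · Reg(w)`. -/
noncomputable def FS {d N : ℕ} (l : Fin N → EuclideanSpace ℝ (Fin d) → ℝ)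
    (Reg : EuclideanSpace ℝ (Fin d) → ℝ) (lam : ℝ)
    (w : EuclideanSpace ℝ (Fin d)) : ℝ :=
  (∑ i, l i w) + lam * Reg w

/-- The deletion-path objective `F_{S,t,i}(w) = F_S(w) − t · ℓ_i(w)`. -/
noncomputable def FSt {d N : ℕ} (l : Fin N → EuclideanSpace ℝ (Fin d) → ℝ)
    (Reg : EuclideanSpace ℝ (Fin d) → ℝ) (lam : ℝ) (i : Fin N) (t : ℝ)
    (w : EuclideanSpace ℝ (Fin d)) : ℝ :=
  FS l Reg lam w - t * l i w

theorem aux_gdiff {d : ℕ} {f : EuclideanSpace ℝ (Fin d) → ℝ} (hf : ContDiff ℝ 2 f) :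
    Differentiable ℝ (gradient f) := by
  have h1 : ContDiff ℝ 1 (fderiv ℝ f) := hf.fderiv_right (by norm_num)
  have h2 : Differentiable ℝ (fderiv ℝ f) := h1.differentiable (by norm_num)
  exact (InnerProductSpace.toDual ℝ (EuclideanSpace ℝ (Fin d))).symm.toContinuousLinearEquiv.differentiable.comp h2

theorem aux_hess {d : ℕ} {f : EuclideanSpace ℝ (Fin d) → ℝ} (hf : ContDiff ℝ 2 f)
    (w : EuclideanSpace ℝ (Fin d)) : HasFDerivAt (gradient f) (hessian f w) w :=
  (aux_gdiff hf w).hasFDerivAt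

theorem aux_gFS {d N : ℕ} (l : Fin N → EuclideanSpace ℝ (Fin d) → ℝ)
    (Reg : EuclideanSpace ℝ (Fin d) → ℝ) (lam : ℝ)
    (hl : ∀ i, ContDiff ℝ 3 (l i)) (hReg : ContDiff ℝ 3 Reg) :
    gradient (FS l Reg lam) = fun w => (∑ i, gradient (l i) w) + lam • gradient Reg w := by
  funext w
  have h1 : ∀ i, HasFDerivAt (l i) (fderiv ℝ (l i) w) w := fun i =>
    ((hl i).differentiable (by norm_num) w).hasFDerivAt
  have h2 := (hReg.differentiable (by norm_num) w).hasFDerivAt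
  have h3 : HasFDerivAt (FS l Reg lam) ((∑ i, fderiv ℝ (l i) w) + lam • fderiv ℝ Reg w) w :=
    (HasFDerivAt.fun_sum (fun i _ => h1 i)).add (h2.const_mul lam)
  simp [gradient, h3.fderiv]

theorem aux_gFSt {d N : ℕ} (l : Fin N → EuclideanSpace ℝ (Fin d) → ℝ)
    (Reg : EuclideanSpace ℝ (Fin d) → ℝ) (lam : ℝ)
    (hl : ∀ i, ContDiff ℝ 3 (l i)) (hF : ContDiff ℝ 3 (FS l Reg lam)) (i : Fin N) (t : ℝ) :
    gradient (FSt l Reg lam i t) = fun w => gradient (FS l Reg lam) w - t • gradient (l i) w := by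
  funext w
  have h1 := ((hl i).differentiable (by norm_num) w).hasFDerivAt
  have h2 := (hF.differentiable (by norm_num) w).hasFDerivAt
  have h3 : HasFDerivAt (FSt l Reg lam i t) (fderiv ℝ (FS l Reg lam) w - t • fderiv ℝ (l i) w) w :=
    h2.sub (h1.const_mul t)
  simp [gradient, h3.fderiv]

theorem aux_coer {d : ℕ} {A : EuclideanSpace ℝ (Fin d) →L[ℝ] EuclideanSpace ℝ (Fin d)} {α : ℝ}
    (hA : ∀ v, α * ‖v‖ ^ 2 ≤ ⟪A v, v⟫) (v : EuclideanSpace ℝ (Fin d)) : α * ‖v‖ ≤ ‖A v‖ := by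
  by_cases hv : v = 0
  · simp [hv]
  · have h0 : 0 < ‖v‖ := norm_pos_iff.mpr hv
    have := (hA v).trans (real_inner_le_norm _ _)
    refine le_of_mul_le_mul_right ?_ h0
    linarith [this]

theorem aux_inv {d : ℕ} {A : EuclideanSpace ℝ (Fin d) →L[ℝ] EuclideanSpace ℝ (Fin d)} {α : ℝ}
    (hα : 0 < α) (hA : ∀ v, α * ‖v‖ ^ 2 ≤ ⟪A v, v⟫) (v : EuclideanSpace ℝ (Fin d)) :
    Ring.inverse A (A v) = v := by
  have hinj : Function.Injective A := by
    rw [injective_iff_map_eq_zero]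
    intro x hx
    have := aux_coer hA x
    rw [hx, norm_zero] at this
    have h0 := norm_nonneg x
    exact norm_eq_zero.mp (by nlinarith)
  have hu : IsUnit A := by
    rw [ContinuousLinearMap.isUnit_iff_bijective]
    exact ⟨hinj, (LinearMap.injective_iff_surjective (f := A.toLinearMap)).mp hinj⟩
  have := Ring.inverse_mul_cancel A hu
  calc Ring.inverse A (A v) = (Ring.inverse A * A) v := rfl
    _ = v := by rw [this]; rfl

/-- Quadratic upper bound from a growth bound on the derivative. -/
theorem aux_taylor {φ φ' : ℝ → ℝ} {C : ℝ}
    (h : ∀ t ∈ Set.Icc (0:ℝ) 1, HasDerivWithinAt φ (φ' t) (Set.Icc 0 1) t)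
    (hb : ∀ t ∈ Set.Icc (0:ℝ) 1, φ' t - φ' 0 ≤ C * t) : φ 1 - φ 0 ≤ φ' 0 + C / 2 := by
  have hd : ∀ t ∈ Set.Icc (0:ℝ) 1, HasDerivWithinAt (fun t => φ t - φ' 0 * t - C / 2 * t ^ 2)
      (φ' t - φ' 0 - C * t) (Set.Icc 0 1) t := by
    intro t ht
    have h1 := ((h t ht).sub ((hasDerivWithinAt_id t _).const_mul (φ' 0))).sub
      (((hasDerivWithinAt_id t (Set.Icc (0:ℝ) 1)).pow 2).const_mul (C/2))
    refine h1.congr_deriv ?_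
    simp; ring
  have ha : AntitoneOn (fun t => φ t - φ' 0 * t - C / 2 * t ^ 2) (Set.Icc 0 1) := by
    refine antitoneOn_of_hasDerivWithinAt_nonpos (f' := fun t => φ' t - φ' 0 - C * t)
      (convex_Icc 0 1) (fun t ht => (hd t ht).continuousWithinAt) ?_ ?_
    · intro t ht
      exact (hd t (interior_subset ht)).mono interior_subset
    · intro t ht
      have := hb t (interior_subset ht)
      linarith
  have := ha (Set.left_mem_Icc.mpr zero_le_one) (Set.right_mem_Icc.mpr zero_le_one) zero_le_one
  simp at this
  linarith

/-- Lipschitz gradient from bounded Hessian. -/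
theorem aux_glip {d : ℕ} {f : EuclideanSpace ℝ (Fin d) → ℝ} (hf : ContDiff ℝ 2 f) {H : ℝ}
    (hH : ∀ w, ‖hessian f w‖ ≤ H) (x y : EuclideanSpace ℝ (Fin d)) :
    ‖gradient f x - gradient f y‖ ≤ H * ‖x - y‖ :=
  convex_univ.norm_image_sub_le_of_norm_hasFDerivWithin_le
    (fun w _ => (aux_hess hf w).hasFDerivWithinAt) (fun w _ => hH w) (Set.mem_univ y) (Set.mem_univ x)

/-- the average change in test loss after deleting a uniformly random training
point satisfies `(1/N)·∑ᵢ [L(ŵ₋ᵢ) − L(ŵ)] ≤ −λD/N + C/2`, where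
`D = ⟨∇L(ŵ), H₀⁻¹(−(1/λ)·∑ᵢ ∇ℓᵢ(ŵ))⟩`, `C = 3HG²/α² + β̄G³/α³`, `β̄ = N·β + λ·β_R`. -/
theorem stmt7 {d N : ℕ} (hd : 1 ≤ d) (hN : 1 ≤ N)
    (l : Fin N → EuclideanSpace ℝ (Fin d) → ℝ)
    (Reg : EuclideanSpace ℝ (Fin d) → ℝ)
    (L : EuclideanSpace ℝ (Fin d) → ℝ)
    (lam G H β βR α : ℝ) (hlam : 0 < lam) (hα : 0 < α)
    -- (A1) smooth losses (C³)
    (hl : ∀ i, ContDiff ℝ 3 (l i))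
    (hlG : ∀ i w, ‖gradient (l i) w‖ ≤ G)
    (hlH : ∀ i w, ‖hessian (l i) w‖ ≤ H)
    (hlLip : ∀ i w v, ‖hessian (l i) w - hessian (l i) v‖ ≤ β * ‖w - v‖)
    -- (A2) smooth regularizer (C³)
    (hReg : ContDiff ℝ 3 Reg)
    (hRegLip : ∀ w v, ‖hessian Reg w - hessian Reg v‖ ≤ βR * ‖w - v‖)
    -- (A3) strong convexity of every F_{S,t,i}
    (hSC : ∀ (i : Fin N) (t : ℝ), t ∈ Set.Icc (0 : ℝ) 1 →
      ∀ w v : EuclideanSpace ℝ (Fin d),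
        α * ‖v‖ ^ 2 ≤ ⟪hessian (FSt l Reg lam i t) w v, v⟫)
    -- test risk is C² with bounded gradient and Hessian
    (hL : ContDiff ℝ 2 L)
    (hLG : ∀ w, ‖gradient L w‖ ≤ G)
    (hLH : ∀ w, ‖hessian L w‖ ≤ H)
    -- minimizers and the connecting curves
    (what : EuclideanSpace ℝ (Fin d))
    (hmin : ∀ v, FS l Reg lam what ≤ FS l Reg lam v)
    (wmin : Fin N → EuclideanSpace ℝ (Fin d))
    (hmin' : ∀ i v, FSt l Reg lam i 1 (wmin i) ≤ FSt l Reg lam i 1 v)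
    (w : Fin N → ℝ → EuclideanSpace ℝ (Fin d))
    (w' : Fin N → ℝ → EuclideanSpace ℝ (Fin d))
    (w'' : Fin N → ℝ → EuclideanSpace ℝ (Fin d))
    (hw : ∀ i, ∀ t ∈ Set.Icc (0 : ℝ) 1,
      HasDerivWithinAt (w i) (w' i t) (Set.Icc (0 : ℝ) 1) t)
    (hw' : ∀ i, ∀ t ∈ Set.Icc (0 : ℝ) 1,
      HasDerivWithinAt (w' i) (w'' i t) (Set.Icc (0 : ℝ) 1) t)
    (hw'' : ∀ i, ContinuousOn (w'' i) (Set.Icc (0 : ℝ) 1))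
    (hopt : ∀ i, ∀ t ∈ Set.Icc (0 : ℝ) 1, gradient (FSt l Reg lam i t) (w i t) = 0)
    (hw0 : ∀ i, w i 0 = what)
    (hw1 : ∀ i, w i 1 = wmin i) :
    (1 / (N : ℝ)) * ∑ i : Fin N, (L (wmin i) - L what)
      ≤ -(lam *
            ⟪gradient L what,
              Ring.inverse (hessian (FS l Reg lam) what)
                ((-(1 / lam)) • ∑ i : Fin N, gradient (l i) what)⟫) / (N : ℝ)
        + (3 * H * G ^ 2 / α ^ 2 + ((N : ℝ) * β + lam * βR) * G ^ 3 / α ^ 3) / 2 := by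
  have hl2 : ∀ i, ContDiff ℝ 2 (l i) := fun i => (hl i).of_le (by norm_num)
  have hReg2 : ContDiff ℝ 2 Reg := hReg.of_le (by norm_num)
  have hF : ContDiff ℝ 3 (FS l Reg lam) :=
    (ContDiff.sum (fun i _ => hl i)).add (contDiff_const.mul hReg)
  have hF2 : ContDiff ℝ 2 (FS l Reg lam) := hF.of_le (by norm_num)
  have hHF : ∀ x, hessian (FS l Reg lam) x = (∑ i, hessian (l i) x) + lam • hessian Reg x := by
    intro x
    have h1 : HasFDerivAt (gradient (FS l Reg lam))
        ((∑ i, hessian (l i) x) + lam • hessian Reg x) x := by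
      rw [aux_gFS l Reg lam hl hReg]
      exact (HasFDerivAt.fun_sum (fun i _ => aux_hess (hl2 i) x)).add
        ((aux_hess hReg2 x).const_smul lam)
    exact h1.fderiv
  have hHt : ∀ i t x, hessian (FSt l Reg lam i t) x
      = hessian (FS l Reg lam) x - t • hessian (l i) x := by
    intro i t x
    have h1 : HasFDerivAt (gradient (FSt l Reg lam i t))
        (hessian (FS l Reg lam) x - t • hessian (l i) x) x := by
      rw [aux_gFSt l Reg lam hl hF]
      exact (aux_hess hF2 x).sub ((aux_hess (hl2 i) x).const_smul t)
    exact h1.fderiv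
  set B : ℝ := (N : ℝ) * β + lam * βR with hB
  have hFLip : ∀ x y, ‖hessian (FS l Reg lam) x - hessian (FS l Reg lam) y‖ ≤ B * ‖x - y‖ := by
    intro x y
    have e : hessian (FS l Reg lam) x - hessian (FS l Reg lam) y
        = (∑ i, (hessian (l i) x - hessian (l i) y)) + lam • (hessian Reg x - hessian Reg y) := by
      rw [hHF, hHF, Finset.sum_sub_distrib, smul_sub]; abel
    rw [e]
    have h1 : ‖∑ i, (hessian (l i) x - hessian (l i) y)‖ ≤ ∑ _i : Fin N, β * ‖x - y‖ :=
      norm_sum_le_of_le _ (fun i _ => hlLip i x y)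
    have h2 : ‖lam • (hessian Reg x - hessian Reg y)‖ ≤ lam * (βR * ‖x - y‖) := by
      rw [norm_smul, Real.norm_of_nonneg hlam.le]
      exact mul_le_mul_of_nonneg_left (hRegLip x y) hlam.le
    refine (norm_add_le _ _).trans ((add_le_add h1 h2).trans (le_of_eq ?_))
    simp [hB]; ring
  have h0m : (0:ℝ) ∈ Set.Icc (0:ℝ) 1 := Set.left_mem_Icc.mpr zero_le_one
  have hG0 : 0 ≤ G := (norm_nonneg _).trans (hLG what)
  have hH0 : 0 ≤ H := (norm_nonneg _).trans (hLH what)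
  have hB0 : 0 ≤ B := by
    have h1 := (norm_nonneg _).trans (hFLip (EuclideanSpace.single ⟨0, hd⟩ 1) 0)
    simpa using h1
  have hA0 : ∀ v, α * ‖v‖ ^ 2 ≤ ⟪hessian (FS l Reg lam) what v, v⟫ := by
    intro v
    have := hSC ⟨0, hN⟩ 0 h0m what v
    simpa [hHt] using this
  -- implicit differentiation
  have hode : ∀ i, ∀ t ∈ Set.Icc (0:ℝ) 1,
      hessian (FSt l Reg lam i t) (w i t) (w' i t) = gradient (l i) (w i t) := by
    intro i t ht
    have e1 := (aux_hess hF2 (w i t)).comp_hasDerivWithinAt t (hw i t ht)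
    have e2 := (hasDerivWithinAt_id t (Set.Icc (0:ℝ) 1)).smul
      ((aux_hess (hl2 i) (w i t)).comp_hasDerivWithinAt t (hw i t ht))
    have e3 := e1.sub e2
    have e4 : HasDerivWithinAt (fun _ : ℝ => (0 : EuclideanSpace ℝ (Fin d))) 0
      (Set.Icc (0:ℝ) 1) t := hasDerivWithinAt_const _ _ _
    have key : ∀ s ∈ Set.Icc (0:ℝ) 1, gradient (FS l Reg lam) (w i s)
        - s • gradient (l i) (w i s) = 0 := by
      intro s hs
      have := hopt i s hs
      rwa [aux_gFSt l Reg lam hl hF] at this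
    have e5 := e4.congr (f₁ := fun s => gradient (FS l Reg lam) (w i s)
      - s • gradient (l i) (w i s)) (fun s hs => key s hs) (key t ht)
    have e6 := (uniqueDiffOn_Icc zero_lt_one t ht).eq_deriv _ e3 e5
    rw [hHt]
    simp at e6 ⊢
    have e7 := sub_eq_zero.mp e6
    rw [e7]; abel
  have hw'b : ∀ i, ∀ t ∈ Set.Icc (0:ℝ) 1, ‖w' i t‖ ≤ G / α := by
    intro i t ht
    have h1 := aux_coer (hSC i t ht (w i t)) (w' i t)
    rw [hode i t ht] at h1
    rw [le_div_iff₀ hα]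
    linarith [hlG i (w i t)]
  have hwb : ∀ i, ∀ t ∈ Set.Icc (0:ℝ) 1, ‖w i t - what‖ ≤ G / α * t := by
    intro i t ht
    have := (convex_Icc (0:ℝ) 1).norm_image_sub_le_of_norm_hasDerivWithin_le
      (hw i) (hw'b i) h0m ht
    rwa [hw0, sub_zero, Real.norm_of_nonneg ht.1] at this
  have hode0 : ∀ i, hessian (FS l Reg lam) what (w' i 0) = gradient (l i) what := by
    intro i
    have := hode i 0 h0m
    simpa [hHt, hw0] using this
  have hdiff : ∀ i, ∀ t ∈ Set.Icc (0:ℝ) 1,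
      ‖w' i t - w' i 0‖ ≤ (2 * H * G / α ^ 2 + B * G ^ 2 / α ^ 3) * t := by
    intro i t ht
    have h1 := aux_coer hA0 (w' i t - w' i 0)
    have e : hessian (FS l Reg lam) what (w' i t - w' i 0)
        = (gradient (l i) (w i t) - gradient (l i) what)
          - (hessian (FS l Reg lam) (w i t) - hessian (FS l Reg lam) what) (w' i t)
          + t • hessian (l i) (w i t) (w' i t) := by
      rw [map_sub, hode0, ← hode i t ht, hHt]
      simp
      abel
    rw [e] at h1
    have hGa : 0 ≤ G / α := by positivity
    have b1 : ‖gradient (l i) (w i t) - gradient (l i) what‖ ≤ H * (G / α * t) :=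
      (aux_glip (hl2 i) (hlH i) _ _).trans (mul_le_mul_of_nonneg_left (hwb i t ht) hH0)
    have b2 : ‖(hessian (FS l Reg lam) (w i t) - hessian (FS l Reg lam) what) (w' i t)‖
        ≤ (B * (G / α * t)) * (G / α) := by
      refine (ContinuousLinearMap.le_opNorm _ _).trans ?_
      refine mul_le_mul ((hFLip _ _).trans (mul_le_mul_of_nonneg_left (hwb i t ht) hB0))
        (hw'b i t ht) (norm_nonneg _) (mul_nonneg hB0 (mul_nonneg hGa ht.1))
    have b3 : ‖t • hessian (l i) (w i t) (w' i t)‖ ≤ t * (H * (G / α)) := by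
      rw [norm_smul, Real.norm_of_nonneg ht.1]
      refine mul_le_mul_of_nonneg_left ?_ ht.1
      exact (ContinuousLinearMap.le_opNorm _ _).trans
        (mul_le_mul (hlH _ _) (hw'b i t ht) (norm_nonneg _) hH0)
    have b4 := h1.trans ((norm_add_le _ _).trans (add_le_add (norm_sub_le _ _) le_rfl))
    have b5 : α * ‖w' i t - w' i 0‖ ≤ α * ((2 * H * G / α ^ 2 + B * G ^ 2 / α ^ 3) * t) := by
      refine (b4.trans (add_le_add (add_le_add b1 b2) b3)).trans (le_of_eq ?_)
      field_simp
      ring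
    exact le_of_mul_le_mul_left b5 hα
  set C : ℝ := 3 * H * G ^ 2 / α ^ 2 + B * G ^ 3 / α ^ 3 with hC
  have hone : ∀ i, L (wmin i) - L what ≤ ⟪gradient L what, w' i 0⟫ + C / 2 := by
    intro i
    have hd1 : ∀ t ∈ Set.Icc (0:ℝ) 1, HasDerivWithinAt (fun t => L (w i t))
        (⟪gradient L (w i t), w' i t⟫) (Set.Icc 0 1) t := by
      intro t ht
      have h3 : (fderiv ℝ L (w i t)) (w' i t) = ⟪gradient L (w i t), w' i t⟫ := by
        simp [gradient]
      rw [← h3]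
      exact (hL.differentiable (by norm_num) (w i t)).hasFDerivAt.comp_hasDerivWithinAt t (hw i t ht)
    have hb1 : ∀ t ∈ Set.Icc (0:ℝ) 1,
        ⟪gradient L (w i t), w' i t⟫ - ⟪gradient L (w i 0), w' i 0⟫ ≤ C * t := by
      intro t ht
      rw [hw0]
      have e : ⟪gradient L (w i t), w' i t⟫ - ⟪gradient L what, w' i 0⟫
          = ⟪gradient L (w i t) - gradient L what, w' i t⟫
            + ⟪gradient L what, w' i t - w' i 0⟫ := by
        rw [inner_sub_left, inner_sub_right]; ring
      rw [e]
      have hGa : 0 ≤ G / α := by positivity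
      have b1 : ⟪gradient L (w i t) - gradient L what, w' i t⟫ ≤ H * (G / α * t) * (G / α) :=
        (real_inner_le_norm _ _).trans (mul_le_mul
          ((aux_glip hL hLH _ _).trans (mul_le_mul_of_nonneg_left (hwb i t ht) hH0))
          (hw'b i t ht) (norm_nonneg _) (mul_nonneg hH0 (mul_nonneg hGa ht.1)))
      have b2 : ⟪gradient L what, w' i t - w' i 0⟫
          ≤ G * ((2 * H * G / α ^ 2 + B * G ^ 2 / α ^ 3) * t) :=
        (real_inner_le_norm _ _).trans (mul_le_mul (hLG _) (hdiff i t ht) (norm_nonneg _) hG0)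
      refine (add_le_add b1 b2).trans (le_of_eq ?_)
      rw [hC]
      field_simp
      ring
    have := aux_taylor hd1 hb1
    simpa [hw0, hw1] using this
  have hNpos : (0:ℝ) < N := by exact_mod_cast hN
  have hsum : ∑ i, (L (wmin i) - L what) ≤ ∑ i, ⟪gradient L what, w' i 0⟫ + N * (C / 2) := by
    refine (Finset.sum_le_sum (fun i _ => hone i)).trans (le_of_eq ?_)
    simp [Finset.sum_add_distrib]
  have hinv : Ring.inverse (hessian (FS l Reg lam) what)
      ((-(1 / lam)) • ∑ i : Fin N, gradient (l i) what) = (-(1 / lam)) • ∑ i, w' i 0 := by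
    have e : (-(1 / lam)) • ∑ i : Fin N, gradient (l i) what
        = hessian (FS l Reg lam) what ((-(1 / lam)) • ∑ i, w' i 0) := by
      rw [map_smul, map_sum]
      simp only [hode0]
    rw [e, aux_inv hα hA0]
  rw [hinv, inner_smul_right, inner_sum]
  have hfin : (1 / (N:ℝ)) * ∑ i, (L (wmin i) - L what)
      ≤ (1 / (N:ℝ)) * (∑ i, ⟪gradient L what, w' i 0⟫ + N * (C / 2)) :=
    mul_le_mul_of_nonneg_left hsum (by positivity)
  refine hfin.trans (le_of_eq ?_)
  field_simp
  try ring
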